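/- Fix an integer t ≥ 2, let q_0 be the dominant zero of 1 − b(q,1,1,1), set p_r = [u^{rt}] b(q_0,u,1,1) for integers r ≥ 1, and set q_* = q_0^{1+1/(t−1)} = q_0^{t/(t−1)}. Then all p_r are strictly positive, and there exist positive constants c, C (depending only on t) such that p_r ≥ c·q_*^r/r and p_r ≤ C·r²·q_*^r for all r ≥ 1. -/

import Mathlib

open scoped BigOperators
open Filter MeasureTheory

noncomputable section

/-- `hp t j = 1 + t + ⋯ + t^(j-1) = (t^j - 1)/(t-1)`. -/
def hp (t j : ℕ) : ℕ := ∑ i ∈ Finset.range j, t ^ i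

/-- The series `b(q,u,v,w)`
`b = Σ_{j≥1} v q^{h_j} u^{t^j} w^j/(1−q^{h_j} u^{t^j}) ∏_{i=1}^{j−1} (1−v−q^{h_i}u^{t^i})/(1−q^{h_i}u^{t^i})`. -/
def bGF (t : ℕ) (q u v w : ℂ) : ℂ :=
  ∑' j : ℕ,
    v * q ^ hp t (j + 1) * u ^ t ^ (j + 1) * w ^ (j + 1) /
        (1 - q ^ hp t (j + 1) * u ^ t ^ (j + 1)) *
      ∏ i ∈ Finset.Icc 1 j,
        (1 - v - q ^ hp t i * u ^ t ^ i) / (1 - q ^ hp t i * u ^ t ^ i)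

/-- The series `a(q,u,v,w)` (for canonical forests with `r` roots)
`a = Σ_{j≥0} v q^{r h_j} u^{r t^j} w^j ∏_{i=1}^{j} (1−v−q^{h_i}u^{t^i})/(1−q^{h_i}u^{t^i})`. -/
def aGF (t r : ℕ) (q u v w : ℂ) : ℂ :=
  ∑' j : ℕ,
    v * q ^ (r * hp t j) * u ^ (r * t ^ j) * w ^ j *
      ∏ i ∈ Finset.Icc 1 j,
        (1 - v - q ^ hp t i * u ^ t ^ i) / (1 - q ^ hp t i * u ^ t ^ i)

/-- A canonical `t`-ary forest with `r` (ordered) roots, encoded by its sequence of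
numbers of internal vertices on each level (a canonical forest is uniquely determined
by this sequence: on each level the leaves come first, since outdegrees read from left
to right are non-decreasing).  The number `c_0` of internal vertices on level `0` is at
most `r`, each level's internal-vertex count satisfies `1 ≤ c_{k+1} ≤ t·c_k`, and the
list stops at the last level containing internal vertices. -/
structure CanonicalForest (t r : ℕ) where
  levels : List ℕ
  pos : ∀ c ∈ levels, 0 < c
  head_le : ∀ c ∈ levels.head?, c ≤ r
  chain : levels.Chain' fun a b => b ≤ t * a

namespace CanonicalForest

variable {t r : ℕ} (T : CanonicalForest t r)

/-- the number `n(T)` of internal vertices -/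
def size : ℕ := T.levels.sum

/-- the height `h(T)`: the maximal distance of a leaf from the root level -/
def height : ℕ := T.levels.length

/-- the number of internal vertices at depth `k` -/
def internAt (k : ℕ) : ℕ := T.levels.getD k 0

/-- the number of vertices at depth `k` -/
def vertsAt (k : ℕ) : ℕ := if k = 0 then r else t * T.internAt (k - 1)

/-- the number of leaves at depth `k` -/
def leavesAt (k : ℕ) : ℕ := T.vertsAt k - T.internAt k

/-- the number `m(T)` of leaves at maximal depth -/
def lastLeaves : ℕ := T.vertsAt T.height

/-- the number `d(T)` of distinct depths at which leaves occur -/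
def distinctDepths : ℕ :=
  ((Finset.range (T.height + 1)).filter fun k => 0 < T.leavesAt k).card

/-- the (leaf-)width `w(T)`: the maximal number of leaves on one level -/
def width : ℕ := (Finset.range (T.height + 1)).sup fun k => T.leavesAt k

/-- the total path length `ℓ(T)`: the sum of the depths of all vertices -/
def pathLength : ℕ := ∑ k ∈ Finset.range (T.height + 1), k * T.vertsAt k

end CanonicalForest

/-- the number of canonical `t`-ary forests with `r` roots and `n` internal vertices -/
def forestCount (t r n : ℕ) : ℕ := Nat.card {T : CanonicalForest t r // T.size = n}

/-- the probability of an event under the uniform distribution on canonical `t`-ary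
forests with `r` roots and `n` internal vertices -/
def forestProb (t r n : ℕ) (s : Set (CanonicalForest t r)) : ℝ :=
  (Nat.card {T : CanonicalForest t r // T.size = n ∧ T ∈ s} : ℝ) / forestCount t r n

/-- the expectation of a random variable under the uniform distribution on canonical
`t`-ary forests with `r` roots and `n` internal vertices -/
def forestExp (t r n : ℕ) (f : CanonicalForest t r → ℝ) : ℝ :=
  (∑ᶠ T : {T : CanonicalForest t r // T.size = n}, f T.1) / forestCount t r n

/-- the variance of a random variable under the uniform distribution on canonical
`t`-ary forests with `r` roots and `n` internal vertices -/
def forestVar (t r n : ℕ) (f : CanonicalForest t r → ℝ) : ℝ :=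
  forestExp t r n (fun T => f T ^ 2) - forestExp t r n f ^ 2

/-- the distribution function of the standard normal distribution -/
def stdGaussCDF (x : ℝ) : ℝ :=
  (Real.sqrt (2 * Real.pi))⁻¹ * ∫ u in Set.Iic x, Real.exp (-u ^ 2 / 2)

/-- the density of the standard normal distribution -/
def stdGaussPDF (x : ℝ) : ℝ :=
  (Real.sqrt (2 * Real.pi))⁻¹ * Real.exp (-x ^ 2 / 2)


/-- the power-series coefficient `[u^m] b(q,u,1,1)` of `u ↦ b(q,u,1,1)` at `u = 0` -/
def bCoeff (t : ℕ) (q : ℂ) (m : ℕ) : ℂ :=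
  iteratedDeriv m (fun u : ℂ => bGF t q u 1 1) 0 / m.factorial

/-- Tail sums of the sequence `p`: `Wf n = 1 - (p 1 + ... + p n)`. -/
def Wf (t : ℕ) (q : ℝ) : ℕ → ℝ
  | 0 => 1
  | (n + 1) => Wf t q n - q ^ (n + 1) * Wf t q (n / t)
decreasing_by
  · omega
  · exact Nat.lt_succ_of_le (Nat.div_le_self n t)

/-- The sequence `p`. -/
def pf (t : ℕ) (q : ℝ) : ℕ → ℝ
  | 0 => 0
  | (n + 1) => q ^ (n + 1) * Wf t q (n / t)

theorem Wf_zero (t : ℕ) (q : ℝ) : Wf t q 0 = 1 := by rw [Wf]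

theorem Wf_succ (t : ℕ) (q : ℝ) (n : ℕ) :
    Wf t q (n + 1) = Wf t q n - q ^ (n + 1) * Wf t q (n / t) := by rw [Wf]

theorem Wf_sub_pf (t : ℕ) (q : ℝ) (n : ℕ) :
    Wf t q (n + 1) = Wf t q n - pf t q (n + 1) := by rw [Wf_succ, pf]

theorem Wf_bdd (t : ℕ) (q : ℝ) (h0 : 0 < q) (h1 : q < 1) :
    ∃ K : ℝ, 0 < K ∧ ∀ n, |Wf t q n| ≤ K := by
  have key : ∀ n, ∀ k ≤ n, |Wf t q k| ≤ Real.exp (∑ i ∈ Finset.range n, q ^ (i + 1)) := by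
    intro n
    induction n with
    | zero => intro k hk; obtain rfl : k = 0 := by omega
              simp [Wf_zero]
    | succ n ih =>
      intro k hk
      have hmono : Real.exp (∑ i ∈ Finset.range n, q ^ (i + 1)) ≤
          Real.exp (∑ i ∈ Finset.range (n + 1), q ^ (i + 1)) := by
        apply Real.exp_le_exp.2
        rw [Finset.sum_range_succ]
        have : 0 < q ^ (n + 1) := by positivity
        linarith
      rcases Nat.lt_or_ge n k with h | h
      · obtain rfl : k = n + 1 := by omega
        rw [Wf_succ, Finset.sum_range_succ, Real.exp_add]
        have h1 := ih n le_rfl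
        have h2 := ih (n / t) (Nat.div_le_self n t)
        have h3 := Real.add_one_le_exp (q ^ (n + 1))
        have hq : 0 < q ^ (n + 1) := by positivity
        have hE := Real.exp_pos (∑ i ∈ Finset.range n, q ^ (i + 1))
        calc |Wf t q n - q ^ (n + 1) * Wf t q (n / t)|
            ≤ |Wf t q n| + |q ^ (n + 1) * Wf t q (n / t)| := abs_sub _ _
          _ = |Wf t q n| + q ^ (n + 1) * |Wf t q (n / t)| := by rw [abs_mul, abs_of_pos hq]
          _ ≤ Real.exp (∑ i ∈ Finset.range n, q ^ (i + 1)) +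
              q ^ (n + 1) * Real.exp (∑ i ∈ Finset.range n, q ^ (i + 1)) := by gcongr
          _ = Real.exp (∑ i ∈ Finset.range n, q ^ (i + 1)) * (q ^ (n + 1) + 1) := by ring
          _ ≤ _ := by gcongr
      · exact (ih k h).trans hmono
  have hs : Summable (fun i : ℕ => q ^ (i + 1)) :=
    (summable_nat_add_iff 1).2 (summable_geometric_of_lt_one h0.le h1)
  refine ⟨Real.exp (∑' i : ℕ, q ^ (i + 1)), Real.exp_pos _, fun n => (key n n le_rfl).trans ?_⟩
  apply Real.exp_le_exp.2
  exact hs.sum_le_tsum _ (fun i _ => by positivity)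

theorem Wf_tail (t : ℕ) (q : ℝ) (h0 : 0 < q) (h1 : q < 1)
    (hlim : Tendsto (Wf t q) atTop (nhds 0)) (k : ℕ) (B : ℝ)
    (hB : ∀ s, k ≤ s → |Wf t q (s / t)| ≤ B) : |Wf t q k| ≤ B * q ^ (k + 1) / (1 - q) := by
  have hB0 : 0 ≤ B := (abs_nonneg _).trans (hB k le_rfl)
  have h1' : 0 < 1 - q := by linarith
  have key : ∀ n, |Wf t q k - Wf t q (n + k)| ≤ B * (q ^ (k + 1) - q ^ (n + k + 1)) / (1 - q) := by
    intro n
    induction n with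
    | zero => simp
    | succ n ih =>
      have e : Wf t q k - Wf t q (n + 1 + k) =
          (Wf t q k - Wf t q (n + k)) + q ^ (n + k + 1) * Wf t q ((n + k) / t) := by
        rw [show n + 1 + k = n + k + 1 by ring, Wf_succ]; ring
      rw [e]
      have hq : 0 < q ^ (n + k + 1) := by positivity
      have h2 := hB (n + k) (by omega)
      calc _ ≤ |Wf t q k - Wf t q (n + k)| + |q ^ (n + k + 1) * Wf t q ((n + k) / t)| :=
            abs_add_le _ _
        _ = |Wf t q k - Wf t q (n + k)| + q ^ (n + k + 1) * |Wf t q ((n + k) / t)| := by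
            rw [abs_mul, abs_of_pos hq]
        _ ≤ B * (q ^ (k + 1) - q ^ (n + k + 1)) / (1 - q) + q ^ (n + k + 1) * B := by gcongr
        _ = _ := by field_simp; ring
  have hl : Tendsto (fun n => |Wf t q k - Wf t q (n + k)|) atTop (nhds |Wf t q k - 0|) :=
    (tendsto_const_nhds.sub ((tendsto_add_atTop_iff_nat k).2 hlim)).abs
  rw [sub_zero] at hl
  refine le_of_tendsto hl (Eventually.of_forall fun n => (key n).trans ?_)
  gcongr
  have : 0 < q ^ (n + k + 1) := by positivity
  linarith

theorem Wf_pos (t : ℕ) (ht : 2 ≤ t) (q : ℝ) (h0 : 0 < q) (h1 : q ≤ 2 / 3)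
    (hlim : Tendsto (Wf t q) atTop (nhds 0)) : ∀ n, 0 < Wf t q n := by
  by_contra hcon
  push Not at hcon
  classical
  let n := Nat.find hcon
  have hn : Wf t q n ≤ 0 := Nat.find_spec hcon
  have hlt : ∀ j, j < n → 0 < Wf t q j := fun j hj => not_le.1 (Nat.find_min hcon hj)
  have hn1 : 1 ≤ n := by
    rcases Nat.eq_zero_or_pos n with h | h
    · rw [h, Wf_zero] at hn; linarith
    · exact h
  have hstep : ∀ m, m < n * t → Wf t q (m + 1) < Wf t q m := by
    intro m hm
    rw [Wf_succ]
    have := hlt (m / t) (by rw [Nat.div_lt_iff_lt_mul (by omega)]; exact hm)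
    have : 0 < q ^ (m + 1) * Wf t q (m / t) := by positivity
    linarith
  have hanti : ∀ d k, k + d ≤ n * t → Wf t q (k + d) ≤ Wf t q k := by
    intro d
    induction d with
    | zero => intro k _; simp
    | succ d ih =>
      intro k hk
      exact (hstep (k + d) (by omega)).le.trans (ih k (by omega))
  have hnt : n + 1 ≤ n * t := by nlinarith
  have hN : Wf t q (n * t) < 0 := by
    have h2 := hanti (n * t - (n + 1)) (n + 1) (by omega)
    rw [show n + 1 + (n * t - (n + 1)) = n * t by omega] at h2
    have := hstep n (by omega)
    linarith
  obtain ⟨K, hK, hKb⟩ := Wf_bdd t q h0 (by linarith)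
  have hcontr : ∀ B : ℝ, (∀ k, n ≤ k → |Wf t q k| ≤ B) → ∀ k, n ≤ k → |Wf t q k| ≤ 8 / 9 * B := by
    intro B hB
    have hB0 : 0 ≤ B := (abs_nonneg _).trans (hB n le_rfl)
    have hbig : ∀ k, n * t ≤ k → |Wf t q k| ≤ 8 / 9 * B := by
      intro k hk
      have h2 := Wf_tail t q h0 (by linarith) hlim k B (fun s hs => hB _ (by
        rw [Nat.le_div_iff_mul_le (by omega)]; omega))
      refine h2.trans ?_
      have h3 : q ^ (k + 1) ≤ q ^ 3 := pow_le_pow_of_le_one h0.le (by linarith) (by nlinarith)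
      have h4 : q ^ 3 ≤ (2 / 3) ^ 3 := by gcongr
      rw [div_le_iff₀ (by linarith)]
      have h5 : q ^ (k + 1) ≤ 8 / 9 * (1 - q) := by
        norm_num at h4; linarith
      nlinarith
    intro k hk
    rcases Nat.lt_or_ge k (n * t) with h | h
    · refine le_trans ?_ (hbig (n * t) le_rfl)
      have h2 := hanti (n * t - k) k (by omega)
      rw [show k + (n * t - k) = n * t by omega] at h2
      have h3 := hanti (k - n) n (by omega)
      rw [show n + (k - n) = k by omega] at h3
      rw [abs_of_nonpos (by linarith), abs_of_neg hN]
      linarith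
    · exact hbig k h
  have hiter : ∀ j : ℕ, ∀ k, n ≤ k → |Wf t q k| ≤ (8 / 9) ^ j * K := by
    intro j
    induction j with
    | zero => intro k _; simpa using hKb k
    | succ j ih =>
      intro k hk
      have := hcontr _ ih k hk
      rw [pow_succ]; linarith
  have hz : |Wf t q (n * t)| ≤ 0 := by
    have hl : Tendsto (fun j : ℕ => ((8:ℝ) / 9) ^ j * K) atTop (nhds (0 * K)) :=
      (tendsto_pow_atTop_nhds_zero_of_lt_one (by norm_num) (by norm_num)).mul_const K
    rw [zero_mul] at hl
    exact ge_of_tendsto hl (Eventually.of_forall fun j => hiter j _ (by omega))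
  have := abs_pos.2 hN.ne
  linarith

theorem pf_bounds (t : ℕ) (ht : 2 ≤ t) (q : ℝ) (h0 : 0 < q) (h1 : q ≤ 2 / 3)
    (hlim : Tendsto (Wf t q) atTop (nhds 0)) :
    (∀ r : ℕ, 1 ≤ r → 0 < pf t q r) ∧
      ∃ c C : ℝ, 0 < c ∧ 0 < C ∧ ∀ r : ℕ, 1 ≤ r →
        c * (q ^ ((t : ℝ) / ((t : ℝ) - 1))) ^ r / r ≤ pf t q r ∧
        pf t q r ≤ C * r ^ 2 * (q ^ ((t : ℝ) / ((t : ℝ) - 1))) ^ r := by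
  have hW := Wf_pos t ht q h0 h1 hlim
  have hpos : ∀ r : ℕ, 1 ≤ r → 0 < pf t q r := by
    intro r hr
    obtain ⟨n, rfl⟩ : ∃ n, r = n + 1 := ⟨r - 1, by omega⟩
    have := hW (n / t)
    rw [pf]; positivity
  have hanti : Antitone (Wf t q) := antitone_nat_of_succ_le fun n => by
    rw [Wf_sub_pf]; linarith [hpos (n + 1) (by omega)]
  have hW1 : ∀ n, Wf t q n ≤ 1 := fun n => by
    have := hanti (Nat.zero_le n); rwa [Wf_zero] at this
  have htail : ∀ k, Wf t q k ≤ 3 * pf t q (k + 1) := by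
    intro k
    have h2 := Wf_tail t q h0 (by linarith) hlim k (Wf t q (k / t)) (fun s hs => by
      rw [abs_of_pos (hW _)]; exact hanti (Nat.div_le_div_right hs))
    rw [abs_of_pos (hW _), le_div_iff₀ (by linarith)] at h2
    rw [pf]
    nlinarith [hW k]
  have hhalf : 1 / 2 ≤ q := by
    have h2 := Wf_tail t q h0 (by linarith) hlim 0 1 (fun s hs => by
      rw [abs_of_pos (hW _)]; exact hW1 _)
    rw [Wf_zero, le_div_iff₀ (by linarith)] at h2
    norm_num at h2
    linarith
  have hq1 : q ≤ 1 := by linarith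
  have htR : (2 : ℝ) ≤ t := by exact_mod_cast ht
  set a : ℝ := (t : ℝ) / ((t : ℝ) - 1) with ha
  have ha1 : a * ((t : ℝ) - 1) = t := by rw [ha]; field_simp [show (t : ℝ) - 1 ≠ 0 by linarith]
  have ha2 : a * t = t + a := by linarith
  have hage : 1 ≤ a := by rw [ha, le_div_iff₀ (by linarith)]; linarith
  set Q : ℝ := q ^ a with hQ
  have hQpos : 0 < Q := Real.rpow_pos_of_pos h0 _
  have hQq : Q ≤ q := by
    have := Real.rpow_le_rpow_of_exponent_ge h0 hq1 hage
    rwa [Real.rpow_one] at this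
  have hQpow : ∀ n : ℕ, Q ^ n = q ^ (a * n) := fun n => by
    rw [hQ, Real.rpow_mul h0.le, Real.rpow_natCast]
  have hqpow : ∀ n : ℕ, q ^ n = q ^ (n : ℝ) := fun n => (Real.rpow_natCast q n).symm
  have hA : (n : ℕ) → (n / t * t : ℕ) ≤ n := fun n => Nat.div_mul_le_self n t
  have hB : (n : ℕ) → n + 1 ≤ (n / t + 1) * t := fun n => Nat.lt_mul_of_div_lt (Nat.lt_succ_self _) (by omega)
  -- comparison inequalities
  have hup : ∀ n : ℕ, q ^ (n + 1) * Q ^ (n / t + 1) ≤ Q ^ (n + 1) := by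
    intro n
    rw [hQpow, hQpow, hqpow, ← Real.rpow_add h0]
    apply Real.rpow_le_rpow_of_exponent_ge h0 hq1
    have h2 : ((n + 1 : ℕ) : ℝ) ≤ ((n / t + 1 : ℕ) : ℝ) * t := by exact_mod_cast hB n
    have h3 : a * ((n + 1 : ℕ) : ℝ) * ((t : ℝ) - 1) = t * ((n + 1 : ℕ) : ℝ) := by rw [mul_right_comm, ha1]
    have h4 : a * ((n / t + 1 : ℕ) : ℝ) * ((t : ℝ) - 1) = t * ((n / t + 1 : ℕ) : ℝ) := by
      rw [mul_right_comm, ha1]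
    have : 0 < (t : ℝ) - 1 := by linarith
    refine le_of_mul_le_mul_right ?_ this
    nlinarith
  have hlow : ∀ n : ℕ, q * Q ^ (n + 1) ≤ q ^ (n + 1) * Q ^ (n / t + 1) := by
    intro n
    rw [hQpow, hQpow, hqpow, ← Real.rpow_add h0]
    nth_rewrite 1 [← Real.rpow_one q]
    rw [← Real.rpow_add h0]
    apply Real.rpow_le_rpow_of_exponent_ge h0 hq1
    have h2 : ((n / t : ℕ) : ℝ) * t ≤ (n : ℝ) := by exact_mod_cast hA n
    have h3 : a * ((n + 1 : ℕ) : ℝ) * ((t : ℝ) - 1) = t * ((n + 1 : ℕ) : ℝ) := by rw [mul_right_comm, ha1]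
    have h4 : a * ((n / t + 1 : ℕ) : ℝ) * ((t : ℝ) - 1) = t * ((n / t + 1 : ℕ) : ℝ) := by
      rw [mul_right_comm, ha1]
    have : 0 < (t : ℝ) - 1 := by linarith
    refine le_of_mul_le_mul_right ?_ this
    rw [add_mul, add_mul, h3, h4]
    push_cast
    nlinarith
  have hWp : ∀ n, pf t q (n + 1) ≤ Wf t q n := fun n => by
    have := Wf_sub_pf t q n
    linarith [hW (n + 1)]
  have hlower : ∀ n : ℕ, 1 ≤ n → Q ^ (n + 1) / n ≤ pf t q (n + 1) := by
    intro n
    induction n using Nat.strong_induction_on with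
    | _ n ih =>
      intro hn
      have hnR : (1 : ℝ) ≤ n := by exact_mod_cast hn
      rw [pf]
      rcases Nat.eq_zero_or_pos (n / t) with h | h
      · rw [h, Wf_zero, mul_one]
        calc Q ^ (n + 1) / n ≤ Q ^ (n + 1) := div_le_self (by positivity) hnR
          _ ≤ _ := by gcongr
      · have h2 := ih (n / t) (Nat.div_lt_self (by omega) (by omega)) h
        have h3 := hWp (n / t)
        have hmR : (1 : ℝ) ≤ ((n / t : ℕ) : ℝ) := by exact_mod_cast h
        have h6 : (0 : ℝ) ≤ ((n / t : ℕ) : ℝ) := by positivity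
        have h5 : ((n / t : ℕ) : ℝ) * t ≤ (n : ℝ) := by exact_mod_cast hA n
        calc Q ^ (n + 1) / n ≤ q * Q ^ (n + 1) / ((n / t : ℕ) : ℝ) := by
              rw [div_le_div_iff₀ (by linarith) (by linarith)]
              have : ((n / t : ℕ) : ℝ) ≤ q * n := by nlinarith
              have hp : 0 < Q ^ (n + 1) := by positivity
              nlinarith
          _ ≤ q ^ (n + 1) * Q ^ (n / t + 1) / ((n / t : ℕ) : ℝ) :=
              div_le_div_of_nonneg_right (hlow n) h6
          _ = q ^ (n + 1) * (Q ^ (n / t + 1) / ((n / t : ℕ) : ℝ)) := by ring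
          _ ≤ q ^ (n + 1) * Wf t q (n / t) := by gcongr; exact h2.trans h3
  have hQ1 : Q ≤ 1 := hQq.trans hq1
  have hupper : ∀ n : ℕ, pf t q (n + 1) ≤ (1 / Q ^ 10) * ((n : ℝ) + 1) ^ 2 * Q ^ (n + 1) := by
    intro n
    induction n using Nat.strong_induction_on with
    | _ n ih =>
      rcases Nat.lt_or_ge n 7 with h | h
      · have h2 : pf t q (n + 1) ≤ 1 := (hWp n).trans (hW1 n)
        refine h2.trans ?_
        have h3 : Q ^ 10 ≤ Q ^ (n + 1) := pow_le_pow_of_le_one hQpos.le hQ1 (by omega)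
        have h4 : 1 ≤ (1 / Q ^ 10) * Q ^ (n + 1) := by
          rw [div_mul_eq_mul_div, one_mul, le_div_iff₀ (by positivity)]; linarith
        have h5 : 1 ≤ ((n : ℝ) + 1) ^ 2 := by
          have : (0 : ℝ) ≤ n := by positivity
          nlinarith
        nlinarith
      · have h2 := ih (n / t) (Nat.div_lt_self (by omega) (by omega))
        have h3 := htail (n / t)
        rw [pf]
        have h5 : ((n / t : ℕ) : ℝ) * t ≤ (n : ℝ) := by exact_mod_cast hA n
        have h6 : (0 : ℝ) ≤ ((n / t : ℕ) : ℝ) := by positivity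
        have h7 : (7 : ℝ) ≤ n := by exact_mod_cast h
        have h8 : ((n / t : ℕ) : ℝ) * 2 ≤ n := by nlinarith
        have h9 : 3 * (((n / t : ℕ) : ℝ) + 1) ^ 2 ≤ ((n : ℝ) + 1) ^ 2 := by nlinarith
        calc q ^ (n + 1) * Wf t q (n / t)
            ≤ q ^ (n + 1) * (3 * ((1 / Q ^ 10) * (((n / t : ℕ) : ℝ) + 1) ^ 2 * Q ^ (n / t + 1))) := by
              gcongr; linarith
          _ = (1 / Q ^ 10) * (3 * (((n / t : ℕ) : ℝ) + 1) ^ 2) * (q ^ (n + 1) * Q ^ (n / t + 1)) := by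
              ring
          _ ≤ (1 / Q ^ 10) * ((n : ℝ) + 1) ^ 2 * Q ^ (n + 1) := by
              gcongr; exact hup n
  refine ⟨hpos, 1, 1 / Q ^ 10, one_pos, by positivity, fun r hr => ?_⟩
  obtain ⟨n, rfl⟩ : ∃ n, r = n + 1 := ⟨r - 1, by omega⟩
  constructor
  · rw [one_mul]
    rcases Nat.eq_zero_or_pos n with h | h
    · subst h
      rw [pf]
      simp [Wf_zero, hQq]
    · refine le_trans ?_ (hlower n h)
      have : (0 : ℝ) < n := by exact_mod_cast h
      push_cast
      gcongr
      linarith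
  · have := hupper n
    push_cast
    exact this

theorem hp_succ (t j : ℕ) : hp t (j + 1) = hp t j + t ^ j := by
  rw [hp, hp, Finset.sum_range_succ]

theorem hp_one (t : ℕ) : hp t 1 = 1 := by simp [hp]

theorem le_hp (t : ℕ) (ht : 2 ≤ t) (j : ℕ) : j ≤ hp t j := by
  induction j with
  | zero => exact Nat.zero_le _
  | succ j ih =>
    rw [hp_succ]
    have : 0 < t ^ j := by positivity
    omega

theorem hp_ge (t : ℕ) (ht : 2 ≤ t) (j : ℕ) : t + 1 ≤ hp t (j + 2) := by
  induction j with
  | zero => rw [hp_succ, hp_one, pow_one]; omega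
  | succ j ih => rw [show j + 1 + 2 = j + 2 + 1 by ring, hp_succ]; omega

/-- `x_i = q^{h_i} u^{t^i}` -/
def xs (t : ℕ) (q u : ℂ) (i : ℕ) : ℂ := q ^ hp t i * u ^ t ^ i

/-- `y_i = -x_i/(1-x_i)` -/
def ys (t : ℕ) (q u : ℂ) (i : ℕ) : ℂ := -xs t q u i / (1 - xs t q u i)

theorem xs_shift (t : ℕ) (q u : ℂ) (i : ℕ) : xs t q (q * u ^ t) i = xs t q u (i + 1) := by
  rw [xs, xs, hp_succ, mul_pow, ← pow_mul, pow_add, pow_succ' t i]; ring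

theorem ys_shift (t : ℕ) (q u : ℂ) (i : ℕ) : ys t q (q * u ^ t) i = ys t q u (i + 1) := by
  rw [ys, ys, xs_shift]

theorem prod_Icc_shift (f : ℕ → ℂ) (j : ℕ) :
    ∏ i ∈ Finset.Icc 1 j, f i = ∏ i ∈ Finset.range j, f (i + 1) := by
  induction j with
  | zero => simp
  | succ j ih => rw [Finset.prod_Icc_succ_top (by omega), ih, Finset.prod_range_succ]

theorem bGF_eq (t : ℕ) (q u : ℂ) :
    bGF t q u 1 1 = ∑' j : ℕ, -∏ i ∈ Finset.range (j + 1), ys t q u (i + 1) := by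
  rw [bGF]
  refine tsum_congr fun j => ?_
  rw [prod_Icc_shift, Finset.prod_range_succ]
  simp only [ys, xs, one_pow, one_mul, mul_one, sub_self, zero_sub]
  ring

theorem xs_norm_le (t : ℕ) (ht : 2 ≤ t) (q : ℝ) (h0 : 0 < q) (h1 : q < 1) (u : ℂ) (hu : ‖u‖ ≤ 1)
    (i : ℕ) : ‖xs t q u i‖ ≤ q ^ i := by
  rw [xs, norm_mul, norm_pow, norm_pow, Complex.norm_real, Real.norm_of_nonneg h0.le]
  calc q ^ hp t i * ‖u‖ ^ t ^ i ≤ q ^ hp t i * 1 := by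
        gcongr; exact pow_le_one₀ (norm_nonneg _) hu
    _ ≤ q ^ i := by rw [mul_one]; exact pow_le_pow_of_le_one h0.le h1.le (le_hp t ht i)

theorem ys_tendsto (t : ℕ) (ht : 2 ≤ t) (q : ℝ) (h0 : 0 < q) (h1 : q < 1) (u : ℂ) (hu : ‖u‖ ≤ 1) :
    Tendsto (ys t q u) atTop (nhds 0) := by
  have hx : Tendsto (xs t q u) atTop (nhds 0) :=
    squeeze_zero_norm (xs_norm_le t ht q h0 h1 u hu)
      (tendsto_pow_atTop_nhds_zero_of_lt_one h0.le h1)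
  have := hx.neg.div (tendsto_const_nhds.sub hx : Tendsto (fun i => 1 - xs t q u i) atTop (nhds (1 - 0)))
    (by simp)
  rw [neg_zero, zero_div] at this
  exact this

theorem prod_ys_summable (t : ℕ) (ht : 2 ≤ t) (q : ℝ) (h0 : 0 < q) (h1 : q < 1) (u : ℂ)
    (hu : ‖u‖ ≤ 1) : Summable (fun j : ℕ => ∏ i ∈ Finset.range j, ys t q u (i + 1)) := by
  refine summable_of_ratio_norm_eventually_le (r := 1 / 2) (by norm_num) ?_
  have h2 := (tendsto_add_atTop_iff_nat 1).2 (ys_tendsto t ht q h0 h1 u hu)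
  have h3 := h2.norm
  rw [norm_zero] at h3
  filter_upwards [h3.eventually_le_const (show (0 : ℝ) < 1 / 2 by norm_num)] with n hn
  rw [Finset.prod_range_succ, norm_mul, mul_comm]
  gcongr

/-- coefficients `[u^m] b` -/
def af (t : ℕ) (q : ℝ) (m : ℕ) : ℝ := if t ∣ m then pf t q (m / t) else 0

theorem pf_summable (t : ℕ) (q : ℝ) (h0 : 0 < q) (h1 : q < 1) :
    Summable (fun r => |pf t q r|) := by
  obtain ⟨K, hK, hb⟩ := Wf_bdd t q h0 h1
  rw [← summable_nat_add_iff 1]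
  refine Summable.of_nonneg_of_le (fun _ => abs_nonneg _) (fun n => ?_)
    (((summable_nat_add_iff 1).2 (summable_geometric_of_lt_one h0.le h1)).mul_right K)
  rw [pf, abs_mul, abs_of_pos (by positivity : 0 < q ^ (n + 1))]
  gcongr
  exact hb _

/-- `F(u) = Σ p_r u^{tr}` -/
def Ff (t : ℕ) (q : ℝ) (u : ℂ) : ℂ := ∑' r : ℕ, (pf t q r : ℂ) * u ^ (r * t)

theorem Ff_term_le (t : ℕ) (q : ℝ) (u : ℂ) (hu : ‖u‖ ≤ 1) (r : ℕ) :
    ‖(pf t q r : ℂ) * u ^ (r * t)‖ ≤ |pf t q r| := by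
  rw [norm_mul, norm_pow, Complex.norm_real, Real.norm_eq_abs]
  exact mul_le_of_le_one_right (abs_nonneg _) (pow_le_one₀ (norm_nonneg _) hu)

theorem Ff_hasSum (t : ℕ) (q : ℝ) (h0 : 0 < q) (h1 : q < 1) (u : ℂ) (hu : ‖u‖ ≤ 1) :
    HasSum (fun r : ℕ => (pf t q r : ℂ) * u ^ (r * t)) (Ff t q u) :=
  (Summable.of_norm_bounded (pf_summable t q h0 h1) (Ff_term_le t q u hu)).hasSum

theorem Ff_norm_le (t : ℕ) (q : ℝ) (h0 : 0 < q) (h1 : q < 1) (u : ℂ) (hu : ‖u‖ ≤ 1) :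
    ‖Ff t q u‖ ≤ ∑' r, |pf t q r| :=
  tsum_of_norm_bounded (pf_summable t q h0 h1).hasSum (Ff_term_le t q u hu)

theorem Ff_hasSum_af (t : ℕ) (ht : 2 ≤ t) (q : ℝ) (h0 : 0 < q) (h1 : q < 1) (u : ℂ)
    (hu : ‖u‖ ≤ 1) : HasSum (fun m : ℕ => (af t q m : ℂ) * u ^ m) (Ff t q u) := by
  have hinj : Function.Injective (fun r : ℕ => r * t) :=
    fun a b h => Nat.eq_of_mul_eq_mul_right (by omega) h
  rw [← hinj.hasSum_iff]
  · convert Ff_hasSum t q h0 h1 u hu using 2 with r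
    simp [af, Nat.mul_div_cancel r (show 0 < t by omega)]
  · intro m hm
    have : ¬ t ∣ m := fun ⟨c, hc⟩ => hm ⟨c, by simp [hc, mul_comm]⟩
    simp [af, this]

theorem Ff_funeq (t : ℕ) (ht : 2 ≤ t) (q : ℝ) (h0 : 0 < q) (h1 : q < 1) (u : ℂ) (hu : ‖u‖ ≤ 1) :
    ‖(q : ℂ) * u ^ t‖ < 1 ∧
    1 - Ff t q u = 1 + ys t q u 1 * (1 - Ff t q (q * u ^ t)) := by
  have hx : ‖(q : ℂ) * u ^ t‖ < 1 := by
    rw [norm_mul, norm_pow, Complex.norm_real, Real.norm_of_nonneg h0.le]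
    exact lt_of_le_of_lt (mul_le_of_le_one_right h0.le (pow_le_one₀ (norm_nonneg _) hu)) h1
  refine ⟨hx, ?_⟩
  have hxs : xs t q u 1 = q * u ^ t := by rw [xs, hp_one, pow_one, pow_one]
  rw [ys, hxs]
  set x : ℂ := (q : ℂ) * u ^ t with hxdef
  have hx1 : 1 - x ≠ 0 := by
    intro h
    have : x = 1 := (sub_eq_zero.1 h).symm
    rw [this, norm_one] at hx
    exact lt_irrefl _ hx
  obtain ⟨K, hK, hb⟩ := Wf_bdd t q h0 h1
  have hS : Summable (fun k : ℕ => (Wf t q (k / t) : ℂ) * x ^ k) := by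
    refine Summable.of_norm_bounded
      ((summable_geometric_of_lt_one (norm_nonneg x) hx).mul_left K) (fun k => ?_)
    rw [norm_mul, norm_pow, Complex.norm_real, Real.norm_eq_abs]
    gcongr
    exact hb _
  obtain ⟨S, hS⟩ := hS
  -- first identity
  have e1 : Ff t q u = x * S := by
    have h2 := (hasSum_nat_add_iff' 1).2 (Ff_hasSum t q h0 h1 u hu)
    simp only [Finset.range_one, Finset.sum_singleton, pf, Complex.ofReal_zero, zero_mul,
      sub_zero] at h2
    refine h2.unique ?_
    have e : (fun n : ℕ => ((q ^ (n + 1) * Wf t q (n / t) : ℝ) : ℂ) * u ^ ((n + 1) * t)) =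
        fun k => x * ((Wf t q (k / t) : ℂ) * x ^ k) := by
      funext k
      push_cast
      rw [hxdef, mul_pow, ← pow_mul]
      ring
    rw [e]
    exact hS.mul_left x
  -- second identity
  have e2 : (1 - x) * S = 1 - Ff t q x := by
    have h2 := (hasSum_nat_add_iff' 1).2 (Ff_hasSum_af t ht q h0 h1 x hx.le)
    have haf0 : af t q 0 = 0 := by simp [af, pf]
    simp only [Finset.range_one, Finset.sum_singleton, haf0, Complex.ofReal_zero, zero_mul,
      sub_zero] at h2
    have h3 := (hasSum_nat_add_iff' 1).2 hS
    simp only [Finset.range_one, Finset.sum_singleton, Nat.zero_div, Wf_zero,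
      Complex.ofReal_one, pow_zero, mul_one] at h3
    have h4 := (hS.mul_left x).sub h3
    have : x * S - (S - 1) = Ff t q x := by
      refine h4.unique ?_
      convert h2 using 2 with k
      rw [af, Nat.succ_div]
      split_ifs with hd
      · rw [Wf_sub_pf]; push_cast; ring
      · simp; ring
    linear_combination -this
  rw [e1]
  field_simp
  linear_combination (-x) * e2

theorem Ff_iter (t : ℕ) (ht : 2 ≤ t) (q : ℝ) (h0 : 0 < q) (h1 : q < 1) (N : ℕ) :
    ∀ u : ℂ, ‖u‖ ≤ 1 → ∃ v : ℂ, ‖v‖ ≤ 1 ∧ 1 - Ff t q u =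
      ∑ j ∈ Finset.range N, ∏ i ∈ Finset.range j, ys t q u (i + 1) +
        (∏ i ∈ Finset.range N, ys t q u (i + 1)) * (1 - Ff t q v) := by
  induction N with
  | zero => intro u hu; exact ⟨u, hu, by simp⟩
  | succ N ih =>
    intro u hu
    obtain ⟨hx, he⟩ := Ff_funeq t ht q h0 h1 u hu
    obtain ⟨v, hv, hv2⟩ := ih _ hx.le
    refine ⟨v, hv, ?_⟩
    rw [he, hv2, Finset.sum_range_succ']
    simp only [Finset.prod_range_succ', ys_shift, Finset.prod_range_zero, zero_add]
    rw [← Finset.sum_mul]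
    ring

theorem bGF_eq_Ff (t : ℕ) (ht : 2 ≤ t) (q : ℝ) (h0 : 0 < q) (h1 : q < 1) (u : ℂ) (hu : ‖u‖ ≤ 1) :
    bGF t q u 1 1 = Ff t q u := by
  rw [bGF_eq]
  have hs := prod_ys_summable t ht q h0 h1 u hu
  have hP := hs.tendsto_atTop_zero
  choose v hv hv2 using fun N => Ff_iter t ht q h0 h1 N u hu
  have hlim : Tendsto (fun N => ∑ j ∈ Finset.range N, ∏ i ∈ Finset.range j, ys t q u (i + 1))
      atTop (nhds (1 - Ff t q u)) := by
    have hz : Tendsto (fun N => (∏ i ∈ Finset.range N, ys t q u (i + 1)) * (1 - Ff t q (v N)))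
        atTop (nhds 0) := by
      refine squeeze_zero_norm (a := fun N => ‖∏ i ∈ Finset.range N, ys t q u (i + 1)‖ *
        (1 + ∑' r, |pf t q r|)) (fun N => ?_) ?_
      · rw [norm_mul]
        gcongr
        refine (norm_sub_le _ _).trans ?_
        rw [norm_one]
        gcongr
        exact Ff_norm_le t q h0 h1 _ (hv N)
      · simpa using hP.norm.mul_const (1 + ∑' r, |pf t q r|)
    have h2 := (tendsto_const_nhds (x := 1 - Ff t q u)).sub hz
    rw [sub_zero] at h2
    refine h2.congr fun N => ?_
    linear_combination hv2 N
  have h3 : HasSum (fun j : ℕ => ∏ i ∈ Finset.range j, ys t q u (i + 1)) (1 - Ff t q u) := by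
    have := tendsto_nhds_unique hs.hasSum.tendsto_sum_nat hlim
    rw [← this]; exact hs.hasSum
  have h4 := ((hasSum_nat_add_iff' 1).2 h3).neg
  simp only [Finset.range_one, Finset.sum_singleton, Finset.prod_range_zero] at h4
  rw [h4.tsum_eq]
  ring

theorem bCoeff_eq (t : ℕ) (ht : 2 ≤ t) (q : ℝ) (h0 : 0 < q) (h1 : q < 1) (r : ℕ) :
    (pf t q r : ℂ) = bCoeff t q (r * t) := by
  have hps : HasFPowerSeriesAt (fun u : ℂ => bGF t q u 1 1)
      (FormalMultilinearSeries.ofScalars ℂ (fun m => (af t q m : ℂ))) 0 := by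
    rw [hasFPowerSeriesAt_iff]
    filter_upwards [Metric.ball_mem_nhds (0 : ℂ) one_pos] with z hz
    have hz1 : ‖z‖ ≤ 1 := by simpa using (mem_ball_zero_iff.1 hz).le
    rw [zero_add, bGF_eq_Ff t ht q h0 h1 z hz1]
    have e : (fun n : ℕ => z ^ n •
        (FormalMultilinearSeries.ofScalars ℂ (fun m => (af t q m : ℂ))).coeff n) =
        fun m => (af t q m : ℂ) * z ^ m := by
      funext m
      rw [FormalMultilinearSeries.coeff_ofScalars, smul_eq_mul, mul_comm]
    rw [e]
    exact Ff_hasSum_af t ht q h0 h1 z hz1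
  obtain ⟨R, hR⟩ := hps
  have h2 := hR.factorial_smul (1 : ℂ) (r * t)
  rw [bCoeff, iteratedDeriv_eq_iteratedFDeriv, ← h2]
  have haf : af t q (r * t) = pf t q r := by
    simp [af, Nat.mul_div_cancel r (show 0 < t by omega)]
  have hf : ((r * t).factorial : ℂ) ≠ 0 := by exact_mod_cast Nat.factorial_ne_zero _
  rw [eq_div_iff hf]
  simp [haf, FormalMultilinearSeries.ofScalars]
  ring

theorem Wf_tendsto (t : ℕ) (ht : 2 ≤ t) (q : ℝ) (h0 : 0 < q) (h1 : q < 1)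
    (hroot : bGF t q 1 1 1 = 1) : Tendsto (Wf t q) atTop (nhds 0) := by
  have h2 := Ff_hasSum t q h0 h1 1 (by simp)
  rw [← bGF_eq_Ff t ht q h0 h1 1 (by simp), hroot] at h2
  have h3 : HasSum (pf t q) 1 := by
    simp only [one_pow, mul_one] at h2
    exact Complex.hasSum_ofReal.1 (by simpa using h2)
  have hW : ∀ n, Wf t q n = 1 - ∑ i ∈ Finset.range (n + 1), pf t q i := by
    intro n
    induction n with
    | zero => simp [Wf_zero, pf]
    | succ n ih => rw [Wf_sub_pf, ih, Finset.sum_range_succ _ (n + 1)]; ring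
  have h4 := (tendsto_const_nhds (x := (1 : ℝ))).sub
    ((tendsto_add_atTop_iff_nat 1).2 h3.tendsto_sum_nat)
  rw [sub_self] at h4
  exact h4.congr fun n => (hW n).symm

/-- the real version of the terms -/
def yr (t : ℕ) (q : ℝ) (i : ℕ) : ℝ := -q ^ hp t i / (1 - q ^ hp t i)

theorem bGF_real (t : ℕ) (q : ℝ) :
    bGF t q 1 1 1 = ((∑' j : ℕ, -∏ i ∈ Finset.range (j + 1), yr t q (i + 1) : ℝ) : ℂ) := by
  rw [bGF_eq, Complex.ofReal_tsum]
  refine tsum_congr fun j => ?_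
  push_cast
  simp [ys, xs, yr]

theorem yr_le (t : ℕ) (ht : 3 ≤ t) (q : ℝ) (h0 : 0 ≤ q) (h1 : q ≤ 2 / 3) (i : ℕ) :
    |yr t q (i + 2)| ≤ 1 / 4 := by
  have h2 : q ^ hp t (i + 2) ≤ q ^ 4 :=
    pow_le_pow_of_le_one h0 (by linarith) (by have := hp_ge t (by omega) i; omega)
  have h3 : q ^ 4 ≤ (2 / 3) ^ 4 := by gcongr
  norm_num at h3
  have h4 : 0 ≤ q ^ hp t (i + 2) := by positivity
  rw [yr, abs_div, abs_neg, abs_of_nonneg h4, abs_of_pos (by linarith), div_le_iff₀ (by linarith)]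
  linarith

theorem term_le (t : ℕ) (ht : 3 ≤ t) (q : ℝ) (h0 : 0 ≤ q) (h1 : q ≤ 2 / 3) (j : ℕ) :
    ‖-∏ i ∈ Finset.range (j + 1), yr t q (i + 1)‖ ≤ 2 * (1 / 4) ^ j := by
  induction j with
  | zero =>
    rw [norm_neg]
    simp only [zero_add, Finset.range_one, Finset.prod_singleton, pow_zero, mul_one]
    rw [yr, hp_one, pow_one, Real.norm_eq_abs, abs_div, abs_neg, abs_of_nonneg h0,
      abs_of_pos (by linarith), div_le_iff₀ (by linarith)]
    linarith
  | succ j ih =>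
    rw [norm_neg] at ih ⊢
    rw [Finset.prod_range_succ, norm_mul, pow_succ, ← mul_assoc]
    gcongr
    exact yr_le t ht q h0 h1 j

theorem q_le (t : ℕ) (ht : 2 ≤ t)
    (q₀ : ℝ) (hq₀lt : q₀ < 1 - 0.72 / t)
    (hq₀uniq : ∀ q : ℂ, ‖q‖ < 1 - 0.72 / t → bGF t q 1 1 1 = 1 → q = (q₀ : ℂ)) : q₀ ≤ 2 / 3 := by
  rcases Nat.lt_or_ge t 3 with h | h
  · obtain rfl : t = 2 := by omega
    norm_num at hq₀lt
    linarith
  have htR : (3 : ℝ) ≤ t := by exact_mod_cast h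
  have hd : (0.72 : ℝ) / t ≤ 0.24 := by
    rw [div_le_iff₀ (by linarith)]; linarith
  have hg : HasSum (fun j : ℕ => 2 * (1 / 4 : ℝ) ^ j) (2 * (1 - 1 / 4)⁻¹) :=
    (hasSum_geometric_of_lt_one (by norm_num) (by norm_num)).mul_left 2
  let β : ℝ → ℝ := fun q => ∑' j : ℕ, -∏ i ∈ Finset.range (j + 1), yr t q (i + 1)
  have hc : ContinuousOn β (Set.Icc 0 (2 / 3)) := by
    refine continuousOn_tsum (fun j => ?_) hg.summable
      (fun j q hq => term_le t h q hq.1 hq.2 j)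
    refine (continuousOn_finsetProd _ fun i _ => ?_).neg
    unfold yr
    refine ContinuousOn.div (by fun_prop) (by fun_prop) (fun q hq => ?_)
    have h2 : q ^ hp t (i + 1) ≤ q := by
      have := pow_le_pow_of_le_one hq.1 (by linarith [hq.2]) (show 1 ≤ hp t (i + 1) by
        have := le_hp t ht (i + 1); omega)
      simpa using this
    have := hq.2
    intro h3
    linarith
  have hβ0 : β 0 = 0 := by
    have : ∀ j : ℕ, -∏ i ∈ Finset.range (j + 1), yr t 0 (i + 1) = 0 := by
      intro j
      rw [neg_eq_zero, Finset.prod_eq_zero_iff]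
      exact ⟨0, by simp, by simp [yr, hp_one]⟩
    simp only [β, this, tsum_zero]
  have hβ1 : 1 ≤ β (2 / 3) := by
    have hs : Summable (fun j : ℕ => -∏ i ∈ Finset.range (j + 1), yr t (2 / 3) (i + 1)) :=
      Summable.of_norm_bounded hg.summable (term_le t h _ (by norm_num) le_rfl)
    have h2 : β (2 / 3) = _ := hs.tsum_eq_zero_add
    have hg2 := (hasSum_nat_add_iff' 1).2 hg
    have h3 := tsum_of_norm_bounded hg2 (fun j => term_le t h (2 / 3) (by norm_num) le_rfl (j + 1))
    have h4 := (abs_le.1 h3).1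
    simp only [Finset.range_one, Finset.sum_singleton, zero_add, Finset.prod_singleton] at h2 h4
    rw [h2]
    have h5 : yr t (2 / 3) 1 = -2 := by rw [yr, hp_one]; norm_num
    rw [h5]
    norm_num at h4 ⊢
    linarith
  obtain ⟨q, hq, hq1⟩ := intermediate_value_Icc (show (0 : ℝ) ≤ 2 / 3 by norm_num) hc
    (show (1 : ℝ) ∈ Set.Icc (β 0) (β (2 / 3)) from ⟨by rw [hβ0]; norm_num, hβ1⟩)
  have h2 := hq₀uniq q (by
    rw [Complex.norm_real, Real.norm_of_nonneg hq.1]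
    have := hq.2
    norm_num at hd ⊢
    linarith) (by
    rw [bGF_real]
    exact_mod_cast hq1)
  have h3 : q = q₀ := by exact_mod_cast h2
  rw [← h3]; exact hq.2

/-- With `p_r = [u^{rt}]b(q₀,u,1,1)` and `q_* = q₀^{t/(t−1)}`:
all `p_r` (`r ≥ 1`) are strictly positive, `p_r = Ω(q_*^r/r)` and `p_r = O(r²·q_*^r)`. -/
theorem p_r_positive_and_bounds (t : ℕ) (ht : 2 ≤ t)
    (q₀ : ℝ) (hq₀pos : 0 < q₀) (hq₀lt : q₀ < 1 - 0.72 / t)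
    (hq₀root : bGF t (q₀ : ℂ) 1 1 1 = 1)
    (hq₀uniq : ∀ q : ℂ, ‖q‖ < 1 - 0.72 / t → bGF t q 1 1 1 = 1 → q = (q₀ : ℂ)) :
    ∃ p : ℕ → ℝ, (∀ r : ℕ, (p r : ℂ) = bCoeff t (q₀ : ℂ) (r * t)) ∧
      (∀ r : ℕ, 1 ≤ r → 0 < p r) ∧
      ∃ c C : ℝ, 0 < c ∧ 0 < C ∧ ∀ r : ℕ, 1 ≤ r →
        c * (q₀ ^ ((t : ℝ) / ((t : ℝ) - 1))) ^ r / r ≤ p r ∧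
        p r ≤ C * r ^ 2 * (q₀ ^ ((t : ℝ) / ((t : ℝ) - 1))) ^ r := by
  have hq1 : q₀ < 1 := by
    have : (0 : ℝ) ≤ 0.72 / t := by positivity
    linarith
  have hle := q_le t ht q₀ hq₀lt hq₀uniq
  have hlim := Wf_tendsto t ht q₀ hq₀pos hq1 hq₀root
  exact ⟨pf t q₀, bCoeff_eq t ht q₀ hq₀pos hq1, pf_bounds t ht q₀ hq₀pos hle hlim⟩

end
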